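/- Occupancy-measure difference identity (first statement of Lemma: om-diff of the paper): Let π be a policy and let P and P̂ be two transition functions; write q = q_{P,π} and q̂ = q_{P̂,π}. Then for every (s,a) ∈ S×A and every h ∈ {1,…,H}: q̂(s,a,h) − q(s,a,h) = Σ_{s'∈S} Σ_{a'∈A} Σ_{s''∈S} Σ_{m=1}^{h−1} q(s',a',m) · (P̂(s',a',m)(s'') − P(s',a',m)(s'')) · q_{P̂,π,(s'',m+1)}(s,a,h). -/

import Mathlib

open Finset

/-- Finite-horizon occupancy measure `q_{P,π,(s̄,h̄)}`, defined recursively over layers: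
zero below layer `h̄`, `π(s,h̄)(a)·𝟙[s = s̄]` at layer `h̄`, and propagated through the
transition function `P` afterwards. -/
noncomputable def occ {S A : Type*} [Fintype S] [Fintype A] [DecidableEq S]
    (π : S → ℕ → A → ℝ) (P : S → A → ℕ → S → ℝ) (sb : S) (hb : ℕ) :
    ℕ → S → A → ℝ
  | 0 => fun s a => if hb = 0 then (if s = sb then π s 0 a else 0) else 0
  | (h + 1) => fun s a =>
      if h + 1 < hb then 0
      else if h + 1 = hb then (if s = sb then π s (h + 1) a else 0)
      else π s (h + 1) a * ∑ s' : S, ∑ a' : A, P s' a' h s * occ π P sb hb h s' a'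

theorem occ_diff_aux {S A : Type*} [Fintype S] [Fintype A] [DecidableEq S]
    (s0 : S) (π : S → ℕ → A → ℝ) (P Phat : S → A → ℕ → S → ℝ) (W : ℕ → S → ℝ)
    (hW : ∀ m s'', W m s'' =
      ∑ s' : S, ∑ a' : A, occ π P s0 1 m s' a' * (Phat s' a' m s'' - P s' a' m s''))
    (n : ℕ) : ∀ (s : S) (a : A),
      occ π Phat s0 1 (n + 1) s a - occ π P s0 1 (n + 1) s a =
        ∑ m ∈ Finset.Icc 1 n, ∑ s'' : S, W m s'' * occ π Phat s'' (m + 1) (n + 1) s a := by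
  induction n with
  | zero => intro s a; simp [occ]
  | succ n ih =>
    intro s a
    have step : ∀ Q : S → A → ℕ → S → ℝ, occ π Q s0 1 (n + 1 + 1) s a =
        π s (n + 1 + 1) a * ∑ s' : S, ∑ a' : A, Q s' a' (n + 1) s * occ π Q s0 1 (n + 1) s' a' := by
      intro Q
      rw [occ]
      beta_reduce
      rw [if_neg (by omega), if_neg (by omega)]
    have last : ∑ s'' : S, W (n + 1) s'' * occ π Phat s'' (n + 1 + 1) (n + 1 + 1) s a
        = W (n + 1) s * π s (n + 1 + 1) a := by
      simp [occ]
    have early : ∀ m ∈ Finset.Icc 1 n,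
        ∑ s'' : S, W m s'' * occ π Phat s'' (m + 1) (n + 1 + 1) s a =
        π s (n + 1 + 1) a * ∑ s' : S, ∑ a' : A, Phat s' a' (n + 1) s *
          ∑ s'' : S, W m s'' * occ π Phat s'' (m + 1) (n + 1) s' a' := by
      intro m hm
      have hm' := Finset.mem_Icc.mp hm
      have : ∀ s'' : S, occ π Phat s'' (m + 1) (n + 1 + 1) s a =
          π s (n + 1 + 1) a * ∑ s' : S, ∑ a' : A,
            Phat s' a' (n + 1) s * occ π Phat s'' (m + 1) (n + 1) s' a' := by
        intro s''
        rw [occ]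
        beta_reduce
        rw [if_neg (by omega), if_neg (by omega)]
      simp only [this, Finset.mul_sum]
      rw [Finset.sum_comm]
      refine Finset.sum_congr rfl fun s' _ => ?_
      rw [Finset.sum_comm]
      refine Finset.sum_congr rfl fun a' _ => Finset.sum_congr rfl fun s'' _ => ?_
      ring
    rw [Finset.sum_Icc_succ_top (by omega), last, Finset.sum_congr rfl early, ← Finset.mul_sum,
      Finset.sum_comm, step, step, hW]
    have e : ∀ s' : S, (∑ m ∈ Finset.Icc 1 n, ∑ a' : A, Phat s' a' (n + 1) s *
          ∑ s'' : S, W m s'' * occ π Phat s'' (m + 1) (n + 1) s' a') =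
        ∑ a' : A, Phat s' a' (n + 1) s *
          (occ π Phat s0 1 (n + 1) s' a' - occ π P s0 1 (n + 1) s' a') := by
      intro s'
      rw [Finset.sum_comm]
      refine Finset.sum_congr rfl fun a' _ => ?_
      rw [ih, Finset.mul_sum]
    simp only [e]
    rw [mul_comm _ (π s (n + 1 + 1) a), ← mul_sub, ← mul_add]
    congr 1
    simp only [← Finset.sum_sub_distrib, ← Finset.sum_add_distrib]
    refine Finset.sum_congr rfl fun s' _ => Finset.sum_congr rfl fun a' _ => ?_
    ring

/-- Occupancy-measure difference identity (first statement of Lemma om-diff):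
`q̂(s,a,h) − q(s,a,h) = ∑_{s',a',s''} ∑_{m=1}^{h−1} q(s',a',m) (P̂(s'',|s',a',m) − P(s''|s',a',m))
  q̂_{(s'',m+1)}(s,a,h)`. -/
theorem om_diff_identity
    {S A : Type*} [Fintype S] [Fintype A] [DecidableEq S] [Nonempty S] [Nonempty A]
    (H : ℕ) (hH : 2 ≤ H) (s0 : S)
    (π : S → ℕ → A → ℝ)
    (hπ0 : ∀ s, ∀ h ∈ Finset.Icc 1 H, ∀ a, 0 ≤ π s h a)
    (hπ1 : ∀ s, ∀ h ∈ Finset.Icc 1 H, ∑ a : A, π s h a = 1)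
    (P Phat : S → A → ℕ → S → ℝ)
    (hP0 : ∀ s a, ∀ h ∈ Finset.Icc 1 (H - 1), ∀ s', 0 ≤ P s a h s')
    (hP1 : ∀ s a, ∀ h ∈ Finset.Icc 1 (H - 1), ∑ s' : S, P s a h s' = 1)
    (hPhat0 : ∀ s a, ∀ h ∈ Finset.Icc 1 (H - 1), ∀ s', 0 ≤ Phat s a h s')
    (hPhat1 : ∀ s a, ∀ h ∈ Finset.Icc 1 (H - 1), ∑ s' : S, Phat s a h s' = 1) :
    ∀ (s : S) (a : A), ∀ h ∈ Finset.Icc 1 H,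
      occ π Phat s0 1 h s a - occ π P s0 1 h s a =
        ∑ s' : S, ∑ a' : A, ∑ s'' : S, ∑ m ∈ Finset.Icc 1 (h - 1),
          occ π P s0 1 m s' a' * (Phat s' a' m s'' - P s' a' m s'') *
            occ π Phat s'' (m + 1) h s a := by
  intro s a h hh
  obtain ⟨n, rfl⟩ : ∃ n, h = n + 1 := ⟨h - 1, by have := Finset.mem_Icc.mp hh; omega⟩
  rw [occ_diff_aux s0 π P Phat _ (fun _ _ => rfl) n s a, Nat.add_sub_cancel]
  simp only [Finset.sum_mul]
  have e1 : ∀ m, (∑ s'' : S, ∑ s' : S, ∑ a' : A, occ π P s0 1 m s' a' *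
      (Phat s' a' m s'' - P s' a' m s'') * occ π Phat s'' (m + 1) (n + 1) s a) =
      ∑ s' : S, ∑ a' : A, ∑ s'' : S, occ π P s0 1 m s' a' *
      (Phat s' a' m s'' - P s' a' m s'') * occ π Phat s'' (m + 1) (n + 1) s a := by
    intro m
    rw [Finset.sum_comm]
    exact Finset.sum_congr rfl fun s' _ => Finset.sum_comm
  simp only [e1]
  rw [Finset.sum_comm]
  refine Finset.sum_congr rfl fun s' _ => ?_
  rw [Finset.sum_comm]
  exact Finset.sum_congr rfl fun a' _ => Finset.sum_comm
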